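/- Let e : ℝ → ℝ and δ ≥ 0 satisfy |e(y) − y| ≤ δ for all y ∈ ℝ. Let v : S × ℝ → ℝ be bounded and 1-Lipschitz in its second argument (|v(s,z₁) − v(s,z₂)| ≤ |z₁ − z₂| for all s, z₁, z₂). Then |T^e v(s,z) − T^p v(s,z)| ≤ γ·δ for all (s,z) ∈ S × ℝ. -/

import Mathlib

/-- The clamp `p(x) = max (−c) (min x c)`. -/
noncomputable def clampP (c : ℝ) (x : ℝ) : ℝ := max (-c) (min x c)

/-- The bounding operator `T^e`:
`T^e v (s, z) = max_{a ∈ A} [min 0 (r s a + z) - min 0 z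
  + γ * Σ_{s'} P(s'|s,a) * v (s', p (e ((r s a + z) / γ)))]`,
where `p` is the clamp to `[-rγ, rγ]`. `T^p` is the case `e = id`. -/
noncomputable def Te {S A : Type*} [Fintype S] [Fintype A] [Nonempty A]
    (P : S → A → PMF S) (r : S → A → ℝ) (γ rγ : ℝ) (e : ℝ → ℝ)
    (v : S × ℝ → ℝ) : S × ℝ → ℝ :=
  fun x => Finset.univ.sup' Finset.univ_nonempty fun a =>
    min 0 (r x.1 a + x.2) - min 0 x.2
      + γ * ∑ s' : S, ((P x.1 a) s').toReal *
          v (s', clampP rγ (e ((r x.1 a + x.2) / γ)))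


theorem abs_clampP_sub_clampP_le (c x y : ℝ) : |clampP c x - clampP c y| ≤ |x - y| := by
  have h₁ := abs_max_sub_max_le_max (-c) (min x c) (-c) (min y c)
  have h₂ := abs_min_sub_min_le_max x c y c
  simp only [sub_self, abs_zero, abs_nonneg, max_eq_left, max_eq_right] at h₁ h₂
  exact h₁.trans h₂

theorem PMF.sum_toReal_eq_one {S : Type*} [Fintype S] (p : PMF S) :
    ∑ s, (p s).toReal = 1 := by
  rw [← ENNReal.toReal_sum fun s _ => p.apply_ne_top s, ← tsum_fintype (L := .unconditional S),
    p.tsum_coe, ENNReal.toReal_one]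

theorem PMF.abs_sum_toReal_mul_sub_le {S : Type*} [Fintype S] (p : PMF S) {f g : S → ℝ} {C : ℝ}
    (h : ∀ s, |f s - g s| ≤ C) :
    |∑ s, (p s).toReal * f s - ∑ s, (p s).toReal * g s| ≤ C := by
  calc |∑ s, (p s).toReal * f s - ∑ s, (p s).toReal * g s|
      = |∑ s, (p s).toReal * (f s - g s)| := by
        simp only [mul_sub, Finset.sum_sub_distrib]
    _ ≤ ∑ s, |(p s).toReal * (f s - g s)| := Finset.abs_sum_le_sum_abs _ _
    _ ≤ ∑ s, (p s).toReal * C := by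
        refine Finset.sum_le_sum fun s _ => ?_
        rw [abs_mul, abs_of_nonneg ENNReal.toReal_nonneg]
        exact mul_le_mul_of_nonneg_left (h s) ENNReal.toReal_nonneg
    _ = C := by rw [← Finset.sum_mul, p.sum_toReal_eq_one, one_mul]

theorem Finset.abs_sup'_sub_sup'_le {ι : Type*} {t : Finset ι} (ht : t.Nonempty) {f g : ι → ℝ}
    {C : ℝ} (h : ∀ i ∈ t, |f i - g i| ≤ C) : |t.sup' ht f - t.sup' ht g| ≤ C := by
  rw [abs_sub_le_iff, sub_le_iff_le_add, sub_le_iff_le_add]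
  constructor <;> refine Finset.sup'_le _ _ fun i hi => ?_
  · linarith [(abs_sub_le_iff.1 (h i hi)).1, Finset.le_sup' g hi]
  · linarith [(abs_sub_le_iff.1 (h i hi)).2, Finset.le_sup' f hi]

/-- if `|e(y) − y| ≤ δ` and `v` is bounded and 1-Lipschitz in its second
argument, then `|T^e v (s,z) − T^p v (s,z)| ≤ γ·δ` for all `(s,z)`. -/
theorem Te_Tp_one_step_bound
    {S A : Type*} [Fintype S] [Nonempty S] [Fintype A] [Nonempty A]
    (P : S → A → PMF S) (r : S → A → ℝ) (r_max : ℝ) (hr_max : 0 < r_max)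
    (hr : ∀ s a, |r s a| ≤ r_max) (γ : ℝ) (hγ : γ ∈ Set.Ioo (0 : ℝ) 1)
    (e : ℝ → ℝ) (δ : ℝ) (hδ : 0 ≤ δ) (he : ∀ y : ℝ, |e y - y| ≤ δ)
    (v : S × ℝ → ℝ)
    (hb : ∃ M : ℝ, ∀ s z, |v (s, z)| ≤ M)
    (hlip : ∀ (s : S) (z₁ z₂ : ℝ), |v (s, z₁) - v (s, z₂)| ≤ |z₁ - z₂|) :
    ∀ s z, |Te P r γ (r_max / (1 - γ)) e v (s, z)
              - Te P r γ (r_max / (1 - γ)) id v (s, z)| ≤ γ * δ := by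
  intro s z
  refine Finset.abs_sup'_sub_sup'_le _ fun a _ => ?_
  rw [add_sub_add_left_eq_sub, ← mul_sub, abs_mul, abs_of_pos hγ.1]
  refine mul_le_mul_of_nonneg_left ?_ hγ.1.le
  exact (P s a).abs_sum_toReal_mul_sub_le fun s' =>
    (hlip s' _ _).trans ((abs_clampP_sub_clampP_le _ _ _).trans (he _))
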